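/- Let A and B be n×n real matrices such that for all real numbers α and β, every complex root of the characteristic polynomial of α·A + β·B is real. Let ψ₁ ≥ ψ₂ ≥ … ≥ ψ_n be the roots of the characteristic polynomial of A and ξ₁ ≥ ξ₂ ≥ … ≥ ξ_n the roots of the characteristic polynomial of B, each listed with multiplicity in decreasing order (all these roots are real by the hypothesis applied with (α,β) = (1,0) and (0,1)). Then max over j of |ψ_j − ξ_j| ≤ ‖A − B‖_F. -/

import Mathlib

open Matrix BigOperators Polynomial

/-- The Frobenius norm of a real matrix. -/
noncomputable def frobNorm {m : ℕ} (M : Matrix (Fin m) (Fin m) ℝ) : ℝ :=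
  Real.sqrt (∑ j, ∑ k, (M j k) ^ 2)

/-- `eigDesc M j` is the `j`-th largest (counted with multiplicity, `j = 0` being the
largest) real part of a root of the characteristic polynomial of `M` over `ℂ`. When all
roots are real, these are exactly the eigenvalues of `M` in decreasing order. -/
noncomputable def eigDesc {m : ℕ} (M : Matrix (Fin m) (Fin m) ℝ) (j : ℕ) : ℝ :=
  (((M.charpoly.map (algebraMap ℝ ℂ)).roots.map Complex.re).sort (· ≥ ·)).getD j 0


def Eig {n : ℕ} (M : Matrix (Fin n) (Fin n) ℝ) (v : Fin n → ℝ) : Prop :=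
  Antitone v ∧ ∀ x : ℝ, (scalar (Fin n) x - M).det = ∏ j, (x - v j)

lemma Eig.charpoly_eq {n : ℕ} {M : Matrix (Fin n) (Fin n) ℝ} {v : Fin n → ℝ} (h : Eig M v) :
    M.charpoly = ∏ j, (X - C (v j)) := by
  apply Polynomial.funext
  intro x
  rw [Matrix.eval_charpoly, h.2 x, Polynomial.eval_prod]
  simp

lemma antitone_unique {n : ℕ} {v w : Fin n → ℝ} (hv : Antitone v) (hw : Antitone w)
    (h : ∀ x : ℝ, ∏ j, (x - v j) = ∏ j, (x - w j)) : v = w := by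
  have h1 : (∏ j, (X - C (v j)) : ℝ[X]) = ∏ j, (X - C (w j)) := by
    apply Polynomial.funext
    intro x
    simpa [Polynomial.eval_prod] using h x
  have h2 := congrArg Polynomial.roots h1
  have e : ∀ u : Fin n → ℝ, (∏ j, (X - C (u j)) : ℝ[X]).roots = (List.ofFn u : Multiset ℝ) := by
    intro u
    have : (∏ j, (X - C (u j)) : ℝ[X]) = ((Finset.univ.val.map u).map (fun a => X - C a)).prod := by
      rw [Multiset.map_map]; rfl
    rw [this, Polynomial.roots_multiset_prod_X_sub_C]
    exact Fin.univ_val_map u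
  rw [e, e, Multiset.coe_eq_coe] at h2
  apply List.ofFn_injective
  exact List.Perm.eq_of_sortedGE (hv.sortedGE_ofFn) (hw.sortedGE_ofFn) h2

lemma Eig.unique {n : ℕ} {M : Matrix (Fin n) (Fin n) ℝ} {v w : Fin n → ℝ}
    (hv : Eig M v) (hw : Eig M w) : v = w :=
  antitone_unique hv.1 hw.1 fun x => (hv.2 x).symm.trans (hw.2 x)

lemma Eig.shift {n : ℕ} {M : Matrix (Fin n) (Fin n) ℝ} {v : Fin n → ℝ} (h : Eig M v) (c : ℝ) :
    Eig (M + c • (1 : Matrix (Fin n) (Fin n) ℝ)) (fun j => v j + c) := by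
  refine ⟨fun i j hij => by have := h.1 hij; simpa using this, fun x => ?_⟩
  have e : scalar (Fin n) x - (M + c • (1 : Matrix (Fin n) (Fin n) ℝ))
      = scalar (Fin n) (x - c) - M := by
    rw [map_sub, Matrix.scalar_apply (α := ℝ) (a := c), ← Matrix.smul_one_eq_diagonal]; abel
  rw [e, h.2]
  exact Finset.prod_congr rfl fun j _ => by ring

lemma Eig.scale {n : ℕ} {M : Matrix (Fin n) (Fin n) ℝ} {v : Fin n → ℝ} (h : Eig M v) {c : ℝ}
    (hc : 0 < c) : Eig (c • M) (fun j => c * v j) := by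
  refine ⟨fun i j hij => mul_le_mul_of_nonneg_left (h.1 hij) hc.le, fun x => ?_⟩
  have e : scalar (Fin n) x - c • M = c • (scalar (Fin n) (x / c) - M) := by
    rw [smul_sub]
    congr 1
    ext i j
    simp only [Matrix.scalar_apply, Matrix.smul_apply, Matrix.diagonal_apply, smul_eq_mul]
    split_ifs
    · field_simp
    · simp
  rw [e, Matrix.det_smul, h.2, Fintype.card_fin]
  have : c ^ n = ∏ _j : Fin n, c := by simp
  rw [this, ← Finset.prod_mul_distrib]
  exact Finset.prod_congr rfl fun j _ => by field_simp

lemma Eig.bound {n : ℕ} {M : Matrix (Fin n) (Fin n) ℝ} {v : Fin n → ℝ} (h : Eig M v) (j : Fin n) :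
    |v j| ≤ frobNorm M := by
  have h0 : (scalar (Fin n) (v j) - M).det = 0 := by
    rw [h.2]; exact Finset.prod_eq_zero (Finset.mem_univ j) (sub_self _)
  obtain ⟨u, hu, hM⟩ := Matrix.exists_mulVec_eq_zero_iff.2 h0
  have hM' : ∀ i, v j * u i = ∑ k, M i k * u k := by
    intro i
    have := congrFun hM i
    rw [Matrix.sub_mulVec] at this
    simp [Matrix.scalar_apply, Matrix.mulVec_diagonal] at this
    have t := sub_eq_zero.1 this
    rw [t]; rfl
  have hpos : 0 < ∑ k, u k ^ 2 := by
    obtain ⟨k, hk⟩ := Function.ne_iff.1 hu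
    have hk' : u k ≠ 0 := hk
    exact Finset.sum_pos' (fun _ _ => sq_nonneg _) ⟨k, Finset.mem_univ _, by positivity⟩
  have key : v j ^ 2 * ∑ k, u k ^ 2 ≤ (∑ i, ∑ k, M i k ^ 2) * ∑ k, u k ^ 2 := by
    rw [Finset.mul_sum, Finset.sum_mul]
    refine Finset.sum_le_sum fun i _ => ?_
    rw [← mul_pow, hM']
    exact Finset.sum_mul_sq_le_sq_mul_sq _ _ _
  exact Real.abs_le_sqrt (le_of_mul_le_mul_right key hpos)

lemma continuous_frobNorm {n : ℕ} : Continuous (frobNorm : Matrix (Fin n) (Fin n) ℝ → ℝ) := by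
  unfold frobNorm
  fun_prop

lemma eig_continuous {n : ℕ} {M : ℝ → Matrix (Fin n) (Fin n) ℝ} (hM : Continuous M)
    {v : ℝ → Fin n → ℝ} (h : ∀ t, Eig (M t) (v t)) : Continuous v := by
  rw [continuous_iff_continuousAt]
  intro t₀
  set R := frobNorm (M t₀) + 1
  have hK : IsCompact (Set.pi Set.univ (fun _ : Fin n => Set.Icc (-R) R) ∩ {w | Antitone w}) := by
    refine (isCompact_univ_pi fun _ => isCompact_Icc).inter_right ?_
    have : {w : Fin n → ℝ | Antitone w} = ⋂ i, ⋂ j, ⋂ (_ : i ≤ j), {w | w j ≤ w i} := by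
      ext w; simp [Antitone]
    rw [this]
    exact isClosed_iInter fun i => isClosed_iInter fun j => isClosed_iInter fun _ =>
      isClosed_le (continuous_apply j) (continuous_apply i)
  refine IsCompact.tendsto_nhds_of_unique_mapClusterPt hK ?_ ?_
  · have : ∀ᶠ t in nhds t₀, frobNorm (M t) < R :=
      (continuous_frobNorm.comp hM).continuousAt.eventually_lt continuousAt_const
        (by simp [R])
    filter_upwards [this] with t ht
    refine ⟨fun j _ => abs_le.1 (((h t).bound j).trans ht.le), (h t).1⟩
  · intro w hw hc
    refine antitone_unique hw.2 (h t₀).1 fun x => ?_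
    have h1 : MapClusterPt (∏ j, (x - w j)) (nhds t₀)
        ((fun u : Fin n → ℝ => ∏ j, (x - u j)) ∘ v) := by
      refine MapClusterPt.continuousAt_comp (f := fun u : Fin n → ℝ => ∏ j, (x - u j)) ?_ hc
      exact Continuous.continuousAt (by fun_prop)
    have h2 : Filter.Tendsto ((fun u : Fin n → ℝ => ∏ j, (x - u j)) ∘ v) (nhds t₀)
        (nhds (∏ j, (x - v t₀ j))) := by
      have e : ((fun u : Fin n → ℝ => ∏ j, (x - u j)) ∘ v)
          = fun t => (scalar (Fin n) x - M t).det := by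
        ext t; exact ((h t).2 x).symm
      rw [e, ← (h t₀).2 x]
      have : Continuous fun t => (scalar (Fin n) x - M t).det :=
        Continuous.matrix_det (continuous_const.sub hM)
      exact this.continuousAt
    exact (t2_iff_nhds.1 inferInstance) (h1.clusterPt.mono h2 : ClusterPt _ _)

lemma eig_exists {n : ℕ} {M : Matrix (Fin n) (Fin n) ℝ}
    (h : ∀ z ∈ (M.charpoly.map (algebraMap ℝ ℂ)).roots, z.im = 0) :
    Eig M (fun j => eigDesc M j) := by
  set s := (M.charpoly.map (algebraMap ℝ ℂ)).roots with hs
  have hsp : (M.charpoly.map (algebraMap ℝ ℂ)).Splits := IsAlgClosed.splits _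
  have hmon : (M.charpoly.map (algebraMap ℝ ℂ)).Monic := M.charpoly_monic.map _
  have hcard : s.card = n := by
    rw [hs, ← hsp.natDegree_eq_card_roots, Polynomial.natDegree_map, Matrix.charpoly_natDegree_eq_dim,
      Fintype.card_fin]
  have hprod : M.charpoly = ((s.map Complex.re).map (fun a => X - C a)).prod := by
    apply Polynomial.map_injective (algebraMap ℝ ℂ) (algebraMap ℝ ℂ).injective
    rw [hsp.eq_prod_roots_of_monic hmon, Polynomial.map_multiset_prod, Multiset.map_map,
      Multiset.map_map]
    congr 1
    refine Multiset.map_congr rfl fun z hz => ?_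
    have : ((z.re : ℝ) : ℂ) = z := by
      apply Complex.ext <;> simp [h z hz]
    simp [this]
  set l := (s.map Complex.re).sort (· ≥ ·) with hl
  have hlen : l.length = n := by simp [hl, hcard]
  have hpw : l.Pairwise (· ≥ ·) := Multiset.pairwise_sort _ _
  have hget : ∀ j : Fin n, eigDesc M j = l[(j : ℕ)]'(by omega) := by
    intro j
    simp only [eigDesc]
    exact List.getD_eq_getElem _ _ (by rw [hlen]; exact j.2)
  have hofn : List.ofFn (fun j : Fin n => eigDesc M j) = l := by
    apply List.ext_getElem
    · simp [hlen]
    · intro i h1 h2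
      simp [hget ⟨i, by omega⟩]
  constructor
  · intro i j hij
    simp only [hget]
    rcases hij.eq_or_lt with rfl | hlt
    · exact le_rfl
    · exact List.pairwise_iff_getElem.1 hpw _ _ _ _ hlt
  · intro x
    rw [← Matrix.eval_charpoly, hprod]
    have : s.map Complex.re = (l : Multiset ℝ) := (Multiset.sort_eq _ _).symm
    rw [this, ← hofn]
    simp [List.prod_ofFn, Polynomial.eval_prod, List.map_ofFn]

noncomputable def Th {n : ℕ} (μ : ℝ → Fin n → ℝ) (x ε t : ℝ) : ℝ :=
  ∑ j, (Real.pi / 2 - Real.arctan ((x - μ t j) / ε))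

lemma polar (a : ℝ) {ε : ℝ} (hε : 0 < ε) :
    ∃ r : ℝ, (a : ℂ) + ε * Complex.I
      = r * Complex.exp (((Real.pi / 2 - Real.arctan (a / ε) : ℝ) : ℂ) * Complex.I) := by
  refine ⟨ε * √(1 + (a / ε) ^ 2), ?_⟩
  have hs : √(1 + (a / ε) ^ 2) ≠ 0 := by positivity
  rw [Complex.exp_mul_I, ← Complex.ofReal_cos, ← Complex.ofReal_sin, Real.cos_pi_div_two_sub,
    Real.sin_pi_div_two_sub, Real.sin_arctan, Real.cos_arctan]
  apply Complex.ext
  · simp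
    field_simp
  · simp
    field_simp

lemma prod_polar {n : ℕ} (μ : ℝ → Fin n → ℝ) (x t : ℝ) {ε : ℝ} (hε : 0 < ε) :
    ∃ r : ℝ, ∏ j, ((x : ℂ) + ε * Complex.I - μ t j)
      = r * Complex.exp ((Th μ x ε t : ℂ) * Complex.I) := by
  choose r hr using fun j => polar (x - μ t j) hε
  refine ⟨∏ j, r j, ?_⟩
  rw [Th, Complex.ofReal_prod, Complex.ofReal_sum, Finset.sum_mul, Complex.exp_sum,
    ← Finset.prod_mul_distrib]
  refine Finset.prod_congr rfl fun j _ => ?_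
  rw [← hr j]
  push_cast
  ring

lemma Th_continuous {n : ℕ} {μ : ℝ → Fin n → ℝ} (hμ : Continuous μ) (x ε : ℝ) :
    Continuous (Th μ x ε) := by
  unfold Th
  have : ∀ j, Continuous fun t => μ t j := fun j => (continuous_apply j).comp hμ
  refine continuous_finsetSum _ fun j _ => ?_
  exact continuous_const.sub (Real.continuous_arctan.comp ((continuous_const.sub (this j)).div_const _))

open Filter Topology in
lemma Th_atTop {n : ℕ} {μ : ℝ → Fin n → ℝ} (h : ∀ j, Tendsto (fun t => μ t j) atTop atTop)
    (x : ℝ) {ε : ℝ} (hε : 0 < ε) : Tendsto (Th μ x ε) atTop (𝓝 (n * Real.pi)) := by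
  have : (n * Real.pi : ℝ) = ∑ _j : Fin n, (Real.pi / 2 - -(Real.pi / 2)) := by simp
  rw [this]
  refine tendsto_finsetSum _ fun j _ => tendsto_const_nhds.sub ?_
  refine (Real.tendsto_arctan_atBot.mono_right nhdsWithin_le_nhds).comp ?_
  refine Tendsto.atBot_div_const hε ?_
  simpa [sub_eq_add_neg] using tendsto_atBot_add_const_left _ x (tendsto_neg_atTop_atBot.comp (h j))

open Filter Topology in
lemma Th_atBot {n : ℕ} {μ : ℝ → Fin n → ℝ} (h : ∀ j, Tendsto (fun t => μ t j) atBot atBot)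
    (x : ℝ) {ε : ℝ} (hε : 0 < ε) : Tendsto (Th μ x ε) atBot (𝓝 0) := by
  have : (0 : ℝ) = ∑ _j : Fin n, (Real.pi / 2 - (Real.pi / 2)) := by simp
  rw [this]
  refine tendsto_finsetSum _ fun j _ => tendsto_const_nhds.sub ?_
  refine (Real.tendsto_arctan_atTop.mono_right nhdsWithin_le_nhds).comp ?_
  refine Tendsto.atTop_div_const hε ?_
  simpa [sub_eq_add_neg] using tendsto_atTop_add_const_left _ x (tendsto_neg_atBot_atTop.comp (h j))

lemma Th_pos {n : ℕ} (hn : 0 < n) (μ : ℝ → Fin n → ℝ) (x ε t : ℝ) : 0 < Th μ x ε t := by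
  have : Nonempty (Fin n) := ⟨⟨0, hn⟩⟩
  refine Finset.sum_pos (fun j _ => ?_) Finset.univ_nonempty
  linarith [Real.arctan_lt_pi_div_two ((x - μ t j) / ε)]

lemma Th_lt {n : ℕ} (hn : 0 < n) (μ : ℝ → Fin n → ℝ) (x ε t : ℝ) :
    Th μ x ε t < n * Real.pi := by
  have : Nonempty (Fin n) := ⟨⟨0, hn⟩⟩
  have : (n * Real.pi : ℝ) = ∑ _j : Fin n, Real.pi := by simp
  rw [this]
  refine Finset.sum_lt_sum_of_nonempty Finset.univ_nonempty (fun j _ => ?_)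
  linarith [Real.neg_pi_div_two_lt_arctan ((x - μ t j) / ε)]

/-- every nondegenerate level is attained at most once -/
lemma level_unique {n : ℕ} {Θ : ℝ → ℝ} (hc : Continuous Θ)
    (hbot : Filter.Tendsto Θ Filter.atBot (nhds 0))
    (htop : Filter.Tendsto Θ Filter.atTop (nhds (n * Real.pi)))
    {Q : ℂ[X]} (hdeg : Q.natDegree ≤ n) {d : ℝ} (hd : d ≠ 0) (hco : Q.coeff n = d)
    (hQ : ∀ t : ℝ, ∃ r : ℝ, Q.eval (t : ℂ) = r * Complex.exp ((Θ t : ℂ) * Complex.I))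
    {c : ℝ} (hc0 : 0 < c) (hcn : c < n * Real.pi) (hs : Real.sin c ≠ 0)
    {s₁ s₂ : ℝ} (h1 : Θ s₁ = c) (h2 : Θ s₂ = c) : s₁ = s₂ := by
  by_contra hne
  have hpi := Real.pi_pos
  set k₀ : ℕ := ⌊c / Real.pi⌋₊ with hk₀
  have hk1 : (k₀ : ℝ) * Real.pi ≤ c := by
    rw [← le_div_iff₀ hpi]; exact Nat.floor_le (by positivity)
  have hk2 : c < (k₀ + 1) * Real.pi := by
    rw [← div_lt_iff₀ hpi]; exact Nat.lt_floor_add_one _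
  set φ := c - k₀ * Real.pi with hφ
  have hφ0 : 0 < φ := by
    rcases hk1.eq_or_lt with e | e
    · exact absurd (by rw [← e]; exact Real.sin_nat_mul_pi _) hs
    · linarith
  have hφ1 : φ < Real.pi := by linarith
  have hk₀n : k₀ < n := by
    have : (k₀ : ℝ) * Real.pi < n * Real.pi := by linarith
    exact_mod_cast lt_of_mul_lt_mul_right this hpi.le
  have hex : ∀ k : Fin n, ∃ t, Θ t = φ + (k : ℕ) * Real.pi := by
    intro k
    have hk : ((k : ℕ) : ℝ) + 1 ≤ n := by exact_mod_cast k.2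
    have a1 : 0 < φ + (k : ℕ) * Real.pi := by positivity
    have a2 : φ + (k : ℕ) * Real.pi < n * Real.pi := by nlinarith
    obtain ⟨a, ha⟩ := (hbot.eventually_lt_const a1).exists
    obtain ⟨b, hb⟩ := (htop.eventually_const_lt a2).exists
    exact mem_range_of_exists_le_of_exists_ge hc ⟨a, ha.le⟩ ⟨b, hb.le⟩
  choose τ hτ using hex
  have hτinj : ∀ k l : Fin n, Θ (τ k) = Θ (τ l) → k = l := by
    intro k l h
    rw [hτ, hτ] at h
    have : ((k : ℕ) : ℝ) = (l : ℕ) := mul_right_cancel₀ hpi.ne' (add_left_cancel h)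
    exact Fin.ext (by exact_mod_cast this)
  obtain ⟨s, hsc, hsne⟩ : ∃ s, Θ s = c ∧ s ≠ τ ⟨k₀, hk₀n⟩ := by
    by_cases h : s₁ = τ ⟨k₀, hk₀n⟩
    · exact ⟨s₂, h2, fun h' => hne (h.trans h'.symm)⟩
    · exact ⟨s₁, h1, h⟩
  have hsne' : ∀ k, s ≠ τ k := by
    intro k hk
    have : Θ (τ k) = Θ (τ ⟨k₀, hk₀n⟩) := by
      rw [← hk, hsc, hτ]; simp [hφ]
    rw [hτinj _ _ this] at hk
    exact hsne hk
  let f : Option (Fin n) → ℂ := fun o => ((o.elim s τ : ℝ) : ℂ)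
  have hf : Function.Injective f := by
    rintro (_ | k) (_ | l) h
    · rfl
    · exact absurd (Complex.ofReal_injective h) (hsne' l)
    · exact absurd (Complex.ofReal_injective h).symm (hsne' k)
    · have := Complex.ofReal_injective h
      simp only [Option.elim] at this
      rw [hτinj k l (by rw [this])]
  set P : ℂ[X] := C (Complex.exp (-(φ * Complex.I))) * Q
    - C (Complex.exp (φ * Complex.I)) * Q.map (starRingEnd ℂ) with hP
  have hPe : ∀ (t : ℝ) (k : ℕ), Θ t = φ + k * Real.pi → P.eval (t : ℂ) = 0 := by
    intro t k ht
    obtain ⟨r, hr⟩ := hQ t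
    have e2 : (Q.map (starRingEnd ℂ)).eval (t : ℂ) = (starRingEnd ℂ) (Q.eval (t : ℂ)) := by
      have := Polynomial.eval_map_apply (p := Q) (f := starRingEnd ℂ) (t : ℂ)
      simpa using this
    rw [hP, Polynomial.eval_sub, Polynomial.eval_C_mul, Polynomial.eval_C_mul, e2, hr, map_mul,
      ← Complex.exp_conj, map_mul, Complex.conj_I, Complex.conj_ofReal, Complex.conj_ofReal, ht]
    rw [mul_left_comm, mul_left_comm _ (r : ℂ), ← Complex.exp_add, ← Complex.exp_add]
    have e3 : -((φ : ℂ) * Complex.I) + ((φ + k * Real.pi : ℝ) : ℂ) * Complex.I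
        = (k * Real.pi : ℂ) * Complex.I := by push_cast; ring
    have e4 : ((φ : ℂ) * Complex.I) + ((φ + k * Real.pi : ℝ) : ℂ) * -Complex.I
        = -((k * Real.pi : ℂ) * Complex.I) := by push_cast; ring
    rw [e3, e4, Complex.exp_neg]
    have e5 : Complex.exp ((k * Real.pi : ℂ) * Complex.I) = (-1) ^ k := by
      rw [mul_assoc, Complex.exp_nat_mul, Complex.exp_pi_mul_I]
    rw [e5]
    rcases neg_one_pow_eq_or ℂ k with h | h <;> rw [h] <;> simp
  have hP0 : P = 0 := by
    refine Polynomial.eq_zero_of_natDegree_lt_card_of_eval_eq_zero P hf ?_ ?_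
    · rintro (_ | k)
      · exact hPe s k₀ (by rw [hsc, hφ]; ring)
      · exact hPe _ k (hτ k)
    · rw [Fintype.card_option, Fintype.card_fin, Nat.lt_succ_iff]
      refine (Polynomial.natDegree_sub_le _ _).trans (max_le ?_ ?_)
      · exact (Polynomial.natDegree_C_mul_le _ _).trans hdeg
      · exact (Polynomial.natDegree_C_mul_le _ _).trans ((Polynomial.natDegree_map_le).trans hdeg)
  have hcoef := congrArg (fun p => Polynomial.coeff p n) hP0
  simp only [hP, Polynomial.coeff_sub, Polynomial.coeff_C_mul, Polynomial.coeff_map, hco,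
    Complex.conj_ofReal, Polynomial.coeff_zero] at hcoef
  have h3 := congrArg Complex.im hcoef
  have e6 : (Complex.exp (-((φ : ℂ) * Complex.I))).im = -Real.sin φ := by
    rw [← neg_mul, ← Complex.ofReal_neg, Complex.exp_ofReal_mul_I_im, Real.sin_neg]
  simp [Complex.exp_ofReal_mul_I_im, e6] at h3
  have hsin : 0 < Real.sin φ := Real.sin_pos_of_pos_of_lt_pi hφ0 hφ1
  have : Real.sin φ * d = 0 := by linarith
  rcases mul_eq_zero.1 this with h | h
  · exact hsin.ne' h
  · exact hd h

lemma Th_mono {n : ℕ} {Θ : ℝ → ℝ} (hc : Continuous Θ)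
    (hbot : Filter.Tendsto Θ Filter.atBot (nhds 0))
    (htop : Filter.Tendsto Θ Filter.atTop (nhds (n * Real.pi)))
    (hpos : ∀ t, 0 < Θ t) (hlt : ∀ t, Θ t < n * Real.pi)
    {Q : ℂ[X]} (hdeg : Q.natDegree ≤ n) {d : ℝ} (hd : d ≠ 0) (hco : Q.coeff n = d)
    (hQ : ∀ t : ℝ, ∃ r : ℝ, Q.eval (t : ℂ) = r * Complex.exp ((Θ t : ℂ) * Complex.I)) :
    Monotone Θ := by
  intro t₁ t₂ h12
  by_contra! hlt'
  have hdense : Dense ({x : ℝ | Real.sin x = 0}ᶜ) := by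
    apply Set.Countable.dense_compl ℝ
    have : {x : ℝ | Real.sin x = 0} = Set.range (fun k : ℤ => (k : ℝ) * Real.pi) := by
      ext x; simp [Real.sin_eq_zero_iff]
    rw [this]
    exact Set.countable_range _
  obtain ⟨c, hcs, hc2, hc1⟩ := hdense.exists_between hlt'
  have hc0 : 0 < c := (hpos t₂).trans hc2
  have hcn : c < n * Real.pi := hc1.trans (hlt t₁)
  obtain ⟨s₁, hs₁, e₁⟩ := intermediate_value_Icc' h12 hc.continuousOn ⟨hc2.le, hc1.le⟩
  obtain ⟨b, hb, hbt⟩ := ((htop.eventually_const_lt hcn).and (Filter.eventually_ge_atTop t₂)).exists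
  obtain ⟨s₂, hs₂, e₂⟩ := intermediate_value_Icc hbt hc.continuousOn ⟨hc2.le, hb.le⟩
  have := level_unique hc hbot htop hdeg hd hco hQ hc0 hcn hcs e₁ e₂
  have : s₁ = t₂ := le_antisymm hs₁.2 (this ▸ hs₂.1)
  rw [this] at e₁
  exact hc2.ne e₁

open Filter Topology in
lemma Th_lim {n : ℕ} (μ : ℝ → Fin n → ℝ) (x t : ℝ) (hx : ∀ j, x ≠ μ t j) :
    Tendsto (fun ε => Th μ x ε t) (𝓝[>] 0) (𝓝 (∑ j, if x < μ t j then Real.pi else 0)) := by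
  unfold Th
  refine tendsto_finsetSum _ fun j _ => ?_
  split_ifs with h
  · have e : Real.pi = Real.pi / 2 - -(Real.pi / 2) := by ring
    conv => rhs; rw [e]
    refine tendsto_const_nhds.sub ?_
    refine (Real.tendsto_arctan_atBot.mono_right nhdsWithin_le_nhds).comp ?_
    exact (tendsto_inv_nhdsGT_zero.const_mul_atTop_of_neg (by linarith)).congr fun _ => (div_eq_mul_inv _ _).symm
  · have e : (0 : ℝ) = Real.pi / 2 - (Real.pi / 2) := by ring
    conv => rhs; rw [e]
    refine tendsto_const_nhds.sub ?_
    refine (Real.tendsto_arctan_atTop.mono_right nhdsWithin_le_nhds).comp ?_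
    have : 0 < x - μ t j := by
      have := lt_of_le_of_ne (not_lt.1 h) (hx j).symm
      linarith
    exact (tendsto_inv_nhdsGT_zero.const_mul_atTop this).congr fun _ => (div_eq_mul_inv _ _).symm

open Filter Topology in
lemma mono_core {n : ℕ} {μ : ℝ → Fin n → ℝ} (hanti : ∀ t, Antitone (μ t))
    (hmono : ∀ x ε, 0 < ε → Monotone (Th μ x ε)) (j : Fin n) : Monotone fun t => μ t j := by
  intro t₁ t₂ h12
  by_contra! hlt
  have hdense : Dense ((Set.range (μ t₁) ∪ Set.range (μ t₂))ᶜ) := by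
    apply Set.Countable.dense_compl ℝ
    exact (Set.countable_range _).union (Set.countable_range _)
  obtain ⟨x, hxs, hx2, hx1⟩ := hdense.exists_between hlt
  have l1 := Th_lim μ x t₁ (fun i h => hxs (Or.inl ⟨i, h.symm⟩))
  have l2 := Th_lim μ x t₂ (fun i h => hxs (Or.inr ⟨i, h.symm⟩))
  have hle := le_of_tendsto_of_tendsto l1 l2
    (by filter_upwards [self_mem_nhdsWithin] with ε hε using hmono x ε hε h12)
  refine absurd hle (not_le.2 ?_)
  have hpi := Real.pi_pos
  refine Finset.sum_lt_sum (fun i _ => ?_) ⟨j, Finset.mem_univ _, ?_⟩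
  · by_cases h : x < μ t₂ i
    · have hij : i ≤ j := by
        by_contra! h'
        exact absurd (hanti t₂ h'.le) (not_le.2 (hx2.trans h))
      have : x < μ t₁ i := hx1.trans_le (hanti t₁ hij)
      simp [h, this]
    · rw [if_neg h]
      split_ifs <;> linarith
  · rw [if_neg (not_lt.2 hx2.le), if_pos hx1]; exact hpi

lemma Eig.complex {n : ℕ} {M : Matrix (Fin n) (Fin n) ℝ} {v : Fin n → ℝ} (h : Eig M v) (z : ℂ) :
    (scalar (Fin n) z - M.map (algebraMap ℝ ℂ)).det = ∏ j, (z - v j) := by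
  have := congrArg (fun p => Polynomial.eval z (p.map (algebraMap ℝ ℂ))) h.charpoly_eq
  simp only [← Matrix.charpoly_map, Matrix.eval_charpoly] at this
  rw [this, Polynomial.map_prod, Polynomial.eval_prod]
  simp

open Filter Topology in
lemma family_mono {n : ℕ} {M D : Matrix (Fin n) (Fin n) ℝ} {v : ℝ → ℝ → Fin n → ℝ}
    (hv : ∀ a b, Eig (a • M + b • D) (v a b))
    (hp : ∀ j, 0 < v 0 1 j) (hm : ∀ j, v 0 (-1) j < 0) (j : Fin n) :
    Monotone fun t => v 1 t j := by
  have hn : 0 < n := j.pos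
  have hscale : ∀ t : ℝ, 0 < t → ∀ b i, v 1 (t * b) i = t * v t⁻¹ b i := by
    intro t ht b i
    have h1 := (hv t⁻¹ b).scale ht
    have e : t • (t⁻¹ • M + b • D) = (1 : ℝ) • M + (t * b) • D := by
      rw [smul_add, smul_smul, smul_smul, mul_inv_cancel₀ ht.ne']
    rw [e] at h1
    exact congrFun ((hv 1 (t * b)).unique h1) i
  have hcont : Continuous (v 1) := eig_continuous (M := fun t => (1 : ℝ) • M + t • D)
    (by fun_prop) (fun t => hv 1 t)
  have hcont' : ∀ b i, Tendsto (fun t : ℝ => v t⁻¹ b i) atTop (𝓝 (v 0 b i)) := by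
    intro b i
    have : Continuous fun s => v s b := eig_continuous (M := fun s => s • M + b • D)
      (by fun_prop) (fun s => hv s b)
    exact (((continuous_apply i).comp this).tendsto 0).comp tendsto_inv_atTop_zero
  have htop : ∀ i, Tendsto (fun t => v 1 t i) atTop atTop := by
    intro i
    have := tendsto_id.atTop_mul_pos (hp i) (hcont' 1 i)
    refine this.congr' ?_
    filter_upwards [eventually_gt_atTop 0] with t ht
    rw [id, ← hscale t ht, mul_one]
  have hbot : ∀ i, Tendsto (fun t => v 1 t i) atBot atBot := by
    intro i
    have := (tendsto_id.atTop_mul_neg (hm i) (hcont' (-1) i)).comp tendsto_neg_atBot_atTop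
    refine this.congr' ?_
    filter_upwards [eventually_lt_atBot 0] with t ht
    simp only [Function.comp, id]
    rw [← hscale (-t) (by linarith)]
    congr 1
    ring
  have hdet : D.det ≠ 0 := by
    have h0 := (hv 0 (-1)).2 0
    rw [show scalar (Fin n) (0:ℝ) - ((0:ℝ) • M + (-1:ℝ) • D) = D by simp] at h0
    rw [h0]
    exact Finset.prod_ne_zero_iff.2 fun i _ => by linarith [hm i]
  refine mono_core (μ := v 1) (fun t => (hv 1 t).1) (fun x ε hε => ?_) j
  let z : ℂ := (x : ℂ) + ε * Complex.I
  let D' : Matrix (Fin n) (Fin n) ℂ := (-D).map (algebraMap ℝ ℂ)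
  let B' : Matrix (Fin n) (Fin n) ℂ := scalar (Fin n) z - M.map (algebraMap ℝ ℂ)
  have hdeg := Polynomial.natDegree_det_X_add_C_le D' B'
  have hco := Polynomial.coeff_det_X_add_C_card D' B'
  rw [Fintype.card_fin] at hdeg hco
  have hD' : D'.det = (((-D).det : ℝ) : ℂ) := by
    have := RingHom.map_det (algebraMap ℝ ℂ) (-D)
    exact this.symm
  refine Th_mono (Th_continuous hcont x ε) (Th_atBot hbot x hε) (Th_atTop htop x hε)
    (Th_pos hn _ x ε) (Th_lt hn _ x ε) hdeg (d := (-D).det) ?_ (hco.trans hD') ?_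
  · rw [Matrix.det_neg]
    exact mul_ne_zero (by simp) hdet
  · intro t
    obtain ⟨r, hr⟩ := prod_polar (v 1) x t hε
    refine ⟨r, ?_⟩
    rw [← hr, ← (hv 1 t).complex]
    have := RingHom.map_det (Polynomial.evalRingHom (t : ℂ))
      ((X : ℂ[X]) • D'.map C + B'.map C)
    rw [Polynomial.coe_evalRingHom] at this
    rw [this]
    congr 1
    ext i k
    simp [D', B', z, Matrix.map_apply, Matrix.diagonal_apply]
    ring

lemma one_side {n : ℕ} {A B : Matrix (Fin n) (Fin n) ℝ}
    (hreal : ∀ α β : ℝ,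
      ∀ z ∈ (((α • A + β • B).charpoly).map (algebraMap ℝ ℂ)).roots, z.im = 0) (j : Fin n) :
    eigDesc A j - eigDesc B j ≤ frobNorm (A - B) := by
  refine le_of_forall_gt_imp_ge_of_dense fun c hc => ?_
  have hE := fun α β => eig_exists (hreal α β)
  set D : Matrix (Fin n) (Fin n) ℝ := B - A + c • (1 : Matrix (Fin n) (Fin n) ℝ) with hD
  have hv : ∀ a b : ℝ, Eig (a • A + b • D)
      (fun i => eigDesc ((a - b) • A + b • B) i + b * c) := by
    intro a b
    have h := (hE (a - b) b).shift (b * c)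
    have e : a • A + b • D = (a - b) • A + b • B + (b * c) • (1 : Matrix (Fin n) (Fin n) ℝ) := by
      rw [hD]; module
    rw [e]
    exact h
  have hfr : ∀ s : ℝ, s ^ 2 = 1 → ∀ i : Fin n,
      |eigDesc ((0 - s) • A + s • B) i| ≤ frobNorm (A - B) := by
    intro s hs i
    refine ((hE (0 - s) s).bound i).trans (le_of_eq ?_)
    unfold frobNorm
    congr 1
    refine Finset.sum_congr rfl fun p _ => Finset.sum_congr rfl fun q _ => ?_
    simp only [Matrix.sub_apply, Matrix.add_apply, Matrix.smul_apply, smul_eq_mul]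
    linear_combination (A p q - B p q) ^ 2 * hs
  have hmono := family_mono hv
    (fun i => by
      have := abs_le.1 (hfr 1 (by norm_num) i)
      linarith [this.1])
    (fun i => by
      have := abs_le.1 (hfr (-1) (by norm_num) i)
      linarith [this.2]) j
  have h01 := hmono (zero_le_one (α := ℝ))
  simp only [sub_zero, one_smul, zero_smul, add_zero, zero_mul, sub_self, zero_add, one_mul] at h01
  linarith

theorem stmt5 (n : ℕ) (hn : 0 < n) (A B : Matrix (Fin n) (Fin n) ℝ)
    (hreal : ∀ α β : ℝ,
      ∀ z ∈ (((α • A + β • B).charpoly).map (algebraMap ℝ ℂ)).roots, z.im = 0) :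
    ∀ j : Fin n, |eigDesc A j - eigDesc B j| ≤ frobNorm (A - B) := by
  intro j
  rw [abs_le]
  have h1 := one_side hreal j
  have h2 := one_side (A := B) (B := A) (fun α β => by rw [add_comm]; exact hreal β α) j
  have e : frobNorm (B - A) = frobNorm (A - B) := by
    unfold frobNorm
    congr 1
    refine Finset.sum_congr rfl fun i _ => Finset.sum_congr rfl fun k _ => ?_
    simp only [Matrix.sub_apply]
    ring
  constructor <;> linarith
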